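/- arXiv:math/0305327 — 2 statements merged into one kernel-verified Lean document; each statement's English description precedes it below -/
import Mathlib

section
/- For all n ≥ 1, the following polynomial identity holds in ℤ[q]: the sum over all 321-avoiding permutations π of {1,…,2n+1} of sign(π)·q^{lis(π)} equals the sum over all 321-avoiding permutations π of {1,…,n} of q^{2·lis(π)+1}. -/
open scoped Classical
open Polynomial

/-- A permutation of `{1,…,n}` (modeled on `Fin n`) is 321-avoiding if there are no
indices `i < j < k` with `π i > π j > π k`. -/
def Avoids321 {n : ℕ} (π : Equiv.Perm (Fin n)) : Prop :=
  ¬ ∃ i j k : Fin n, i < j ∧ j < k ∧ π k < π j ∧ π j < π i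

/-- The length of the longest increasing subsequence of a permutation. -/
noncomputable def lis {n : ℕ} (π : Equiv.Perm (Fin n)) : ℕ :=
  sSup {k : ℕ | ∃ s : Finset (Fin n),
    (∀ i ∈ s, ∀ j ∈ s, i < j → π i < π j) ∧ s.card = k}

/-- The permutation with first value `v` whose remaining values are ordered as `σ`. -/
def consPerm {m : ℕ} (v : Fin (m + 1)) (σ : Equiv.Perm (Fin m)) : Equiv.Perm (Fin (m + 1)) :=
  v.cycleRange.symm * Equiv.Perm.decomposeFin.symm (0, σ)

section Words

/-- `firstFalse q j` says that the first `j` letters of `q` are all `false`. -/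
def firstFalse : List Bool → ℕ → Bool
  | _, 0 => true
  | false :: q, j + 1 => firstFalse q j
  | true :: _, _ + 1 => false
  | [], _ + 1 => false

/-- `insertable q j` says that the first `j` letters of `q` are a block of `true` followed by a
block of `false`. -/
def insertable : List Bool → ℕ → Bool
  | _, 0 => true
  | false :: q, j + 1 => firstFalse q j
  | true :: q, j + 1 => insertable q j
  | [], _ + 1 => false

/-- Row insertion of a new entry in a two-row standard tableau, encoded by the word `q` whose
`i`-th letter tells whether the entry `i` lies in the first row: a letter `true` is inserted after
the first `j` letters, and the last `true` before it, if any, becomes `false`. -/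
def rowInsert : List Bool → ℕ → List Bool
  | q, 0 => true :: q
  | false :: q, j + 1 => false :: rowInsert q j
  | true :: q, j + 1 => (!firstFalse q j) :: rowInsert q j
  | [], _ + 1 => [true]

lemma insertable_of_firstFalse {q : List Bool} {t : ℕ} (h : firstFalse q t) : insertable q t := by
  induction q generalizing t with
  | nil => cases t <;> simp_all [firstFalse, insertable]
  | cons x q ih => cases t <;> cases x <;> simp_all [firstFalse, insertable]

lemma length_rowInsert {q : List Bool} {t : ℕ} (h : t ≤ q.length) :
    (rowInsert q t).length = q.length + 1 := by
  induction q generalizing t with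
  | nil => cases t <;> simp_all [rowInsert]
  | cons x q ih => cases t <;> cases x <;> simp_all [rowInsert]

lemma count_drop_of_firstFalse {q : List Bool} {t : ℕ} (h : firstFalse q t) :
    (q.drop t).count true = q.count true := by
  induction q generalizing t with
  | nil => simp
  | cons x q ih => cases t <;> cases x <;> simp_all [firstFalse]

lemma count_drop_lt {q : List Bool} {t : ℕ} (ht : t ≤ q.length) (h : firstFalse q t = false) :
    (q.drop t).count true < q.count true := by
  induction q generalizing t with
  | nil => cases t <;> simp_all [firstFalse]
  | cons x q ih =>
    cases t with
    | zero => simp [firstFalse] at h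
    | succ t =>
      cases x
      · simpa using ih (by simpa using ht) h
      · simpa [Nat.lt_succ_iff] using (List.drop_sublist t q).count_le true

lemma count_drop_rowInsert {q : List Bool} {t j : ℕ} (ht : t ≤ q.length) (h : insertable q t)
    (hj : j ≤ t) : ((rowInsert q t).drop j).count true =
      max ((q.drop j).count true) ((q.drop t).count true + 1) := by
  induction q generalizing t j with
  | nil => obtain rfl : t = 0 := by simpa using ht
           obtain rfl : j = 0 := by simpa using hj
           simp [rowInsert]
  | cons x q ih =>
    cases t with
    | zero => obtain rfl : j = 0 := by simpa using hj
              simp [rowInsert]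
    | succ t =>
      have ht' : t ≤ q.length := by simpa using ht
      have hi : insertable q t := by
        cases x
        · exact insertable_of_firstFalse h
        · exact h
      cases j with
      | succ j =>
        cases x <;> simpa [rowInsert] using ih ht' hi (by omega)
      | zero =>
        have := ih ht' hi (Nat.zero_le t)
        simp only [List.drop_zero] at this
        cases x
        · simpa [rowInsert] using this
        · cases hf : firstFalse q t
          · have := count_drop_lt ht' hf
            simp [rowInsert, hf]
            omega
          · have := count_drop_of_firstFalse hf
            simp [rowInsert, hf]
            omega

lemma drop_rowInsert {q : List Bool} {t j : ℕ} (ht : t ≤ q.length) (hj : t < j) :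
    (rowInsert q t).drop j = q.drop (j - 1) := by
  induction q generalizing t j with
  | nil => obtain rfl : t = 0 := by simpa using ht
           obtain ⟨j, rfl⟩ := Nat.exists_eq_succ_of_ne_zero (by omega : j ≠ 0)
           simp [rowInsert]
  | cons x q ih =>
    obtain ⟨j, rfl⟩ := Nat.exists_eq_succ_of_ne_zero (by omega : j ≠ 0)
    cases t with
    | zero => simp [rowInsert]
    | succ t =>
      obtain ⟨j, rfl⟩ := Nat.exists_eq_succ_of_ne_zero (by omega : j ≠ 0)
      have := ih (by simpa using ht) (by omega : t < j + 1)
      cases x <;> simpa [rowInsert] using this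

lemma firstFalse_rowInsert {q : List Bool} {t : ℕ} (j : ℕ) (h : firstFalse q t) :
    firstFalse (rowInsert q t) j = decide (j ≤ t) := by
  induction q generalizing t j with
  | nil => cases t <;> cases j <;> simp_all [firstFalse, rowInsert]
  | cons x q ih => cases t <;> cases j <;> cases x <;> simp_all [firstFalse, rowInsert]

lemma insertable_rowInsert {q : List Bool} {t j : ℕ} (h : insertable q t) :
    insertable (rowInsert q t) j ↔ j ≤ t ∨ t = 0 ∧ insertable q (j - 1) := by
  induction q generalizing t j with
  | nil => cases t <;> cases j <;> simp_all [insertable, rowInsert]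
  | cons x q ih =>
    cases t with
    | zero => cases j <;> simp_all [insertable, rowInsert]
    | succ t =>
      cases j with
      | zero => simp [insertable]
      | succ j =>
        cases x
        · simp [rowInsert, insertable, firstFalse_rowInsert j h]
        · cases hf : firstFalse q t
          · have ht : t ≠ 0 := by rintro rfl; simp [firstFalse] at hf
            simpa [rowInsert, hf, insertable, ht] using ih (j := j) h
          · simp [rowInsert, hf, insertable, firstFalse_rowInsert j hf]

end Words

section Operators

variable {R : Type*} [CommRing R]

/-- The weighted sum over all row insertions into `q`. -/
def insertSum (ε : R) (φ : List Bool → R) (q : List Bool) : R :=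
  ∑ j ∈ Finset.range (q.length + 1), if insertable q j then ε ^ j * φ (rowInsert q j) else 0

/-- The part of `insertSum` in which the first row grows. -/
def growFirst (ε : R) : (List Bool → R) → List Bool → R
  | φ, [] => φ [true]
  | φ, true :: q => φ (true :: true :: q)
  | φ, false :: q => φ (true :: false :: q) + ε * growFirst ε (fun p => φ (false :: p)) q

/-- The part of `insertSum` in which the second row grows. -/
def growSecond (ε : R) : (List Bool → R) → List Bool → R
  | _, [] => 0
  | _, false :: _ => 0
  | φ, true :: q =>
    ε * (growFirst ε (fun p => φ (false :: p)) q + growSecond ε (fun p => φ (true :: p)) q)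

lemma growFirst_eq_sum (ε : R) (φ : List Bool → R) (q : List Bool) :
    growFirst ε φ q = ∑ j ∈ Finset.range (q.length + 1),
      if firstFalse q j then ε ^ j * φ (rowInsert q j) else 0 := by
  induction q generalizing φ with
  | nil => simp [growFirst, firstFalse, rowInsert]
  | cons x q ih =>
    rw [Finset.sum_range_succ']
    cases x
    · simp only [growFirst, ih, Finset.mul_sum, firstFalse, rowInsert]
      rw [add_comm]
      congr 1
      · simp only [List.length_cons]
        refine Finset.sum_congr rfl fun j _ => ?_
        by_cases h : firstFalse q j <;> simp [h, pow_succ]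
        ring
      · simp
    · simp [growFirst, firstFalse, rowInsert]

lemma growSecond_eq_sum (ε : R) (φ : List Bool → R) (q : List Bool) :
    growSecond ε φ q = ∑ j ∈ Finset.range (q.length + 1),
      if insertable q j ∧ ¬ firstFalse q j then ε ^ j * φ (rowInsert q j) else 0 := by
  induction q generalizing φ with
  | nil => simp [growSecond, firstFalse]
  | cons x q ih =>
    rw [Finset.sum_range_succ']
    cases x
    · simp [growSecond, firstFalse, insertable]
    · simp only [growSecond, ih, growFirst_eq_sum, ← Finset.sum_add_distrib, Finset.mul_sum,
        List.length_cons, firstFalse, insertable, rowInsert]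
      simp only [not_true_eq_false, and_false, if_false, add_zero]
      refine Finset.sum_congr rfl fun j _ => ?_
      cases hf : firstFalse q j
      · by_cases hi : insertable q j <;> simp [hi]; ring
      · simp [insertable_of_firstFalse hf]; ring

lemma insertSum_eq (ε : R) (φ : List Bool → R) (q : List Bool) :
    insertSum ε φ q = growFirst ε φ q + growSecond ε φ q := by
  rw [insertSum, growFirst_eq_sum, growSecond_eq_sum, ← Finset.sum_add_distrib]
  refine Finset.sum_congr rfl fun j _ => ?_
  cases hf : firstFalse q j
  · simp
  · simp [insertable_of_firstFalse hf]

/-- The sum of `ε ^ inv(p) * φ p` over the standard tableaux `p` of shape `(m - k, k)`. -/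
def tableauSum (ε : R) : ℕ → ℕ → (List Bool → R) → R
  | 0, 0, φ => φ []
  | 0, _ + 1, _ => 0
  | m + 1, 0, φ => tableauSum ε m 0 (fun p => φ (true :: p))
  | m + 1, k + 1, φ =>
    if 2 * (k + 1) ≤ m + 1 then
      ε ^ (k + 1) * tableauSum ε m (k + 1) (fun p => φ (true :: p)) +
        tableauSum ε m k (fun p => φ (false :: p))
    else 0

lemma tableauSum_eq_zero (ε : R) {m k : ℕ} (h : m < 2 * k) (φ : List Bool → R) :
    tableauSum ε m k φ = 0 := by
  cases m <;> cases k <;> simp_all [tableauSum]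

lemma tableauSum_add (ε : R) (m k : ℕ) (φ ψ : List Bool → R) :
    tableauSum ε m k (fun p => φ p + ψ p) = tableauSum ε m k φ + tableauSum ε m k ψ := by
  induction m generalizing k φ ψ with
  | zero => cases k <;> simp [tableauSum]
  | succ m ih =>
    cases k
    · simp [tableauSum, ih]
    · simp only [tableauSum, ih]
      split_ifs
      · ring
      · simp

lemma tableauSum_mul (ε : R) (m k : ℕ) (c : R) (φ : List Bool → R) :
    tableauSum ε m k (fun p => c * φ p) = c * tableauSum ε m k φ := by
  induction m generalizing k φ with
  | zero => cases k <;> simp [tableauSum]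
  | succ m ih =>
    cases k
    · simp [tableauSum, ih]
    · simp only [tableauSum, ih]
      split_ifs
      · ring
      · simp

lemma tableauSum_growFirst {ε : R} (hε : ε * ε = 1) {m k : ℕ} (h : 2 * k ≤ m)
    (φ : List Bool → R) :
    tableauSum ε m k (growFirst ε φ) = ε ^ k * tableauSum ε (m + 1) k φ := by
  have hp (j : ℕ) : ε ^ j * ε ^ j = 1 := by rw [← mul_pow, hε, one_pow]
  induction m generalizing k φ with
  | zero =>
    obtain rfl : k = 0 := by omega
    simp [tableauSum, growFirst]
  | succ m ih =>
    cases k with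
    | zero => simp [tableauSum, growFirst]
    | succ k =>
      rw [tableauSum, tableauSum, if_pos h, if_pos (by omega)]
      simp only [growFirst, tableauSum_add, tableauSum_mul]
      rw [ih (by omega), tableauSum, if_pos h]
      linear_combination (-ε ^ (k + 1) * tableauSum ε m (k + 1) (fun p => φ (true :: true :: p))
        - tableauSum ε m k fun p => φ (true :: false :: p)) * hp (k + 1)

lemma tableauSum_growSecond {ε : R} (hε : ε * ε = 1) (m k : ℕ) (φ : List Bool → R) :
    tableauSum ε m k (growSecond ε φ) = ε * tableauSum ε (m + 1) (k + 1) φ := by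
  have hp (j : ℕ) : ε ^ j * ε ^ j = 1 := by rw [← mul_pow, hε, one_pow]
  have hz (m k : ℕ) : tableauSum ε m k (fun _ => (0 : R)) = 0 := by
    simpa using tableauSum_mul ε m k 0 (fun _ => (0 : R))
  induction m generalizing k φ with
  | zero => cases k <;> simp [tableauSum, growSecond]
  | succ m ih =>
    rcases lt_or_ge m (2 * k) with h | h
    · rw [tableauSum_eq_zero (m := m + 1 + 1) ε (by omega)]
      cases k with
      | zero => omega
      | succ k =>
        simp only [tableauSum, growSecond, hz, tableauSum_eq_zero ε h]
        simp
    · have key : tableauSum ε m k (fun p => growSecond ε φ (true :: p)) =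
          ε * (ε ^ k * tableauSum ε (m + 1) k (fun p => φ (false :: p)) +
            ε * tableauSum ε (m + 1) (k + 1) (fun p => φ (true :: p))) := by
        simp only [growSecond, tableauSum_add, tableauSum_mul]
        rw [tableauSum_growFirst hε h, ih]
      have key' : tableauSum ε (m + 1) k (growSecond ε φ) =
          ε ^ k * tableauSum ε m k (fun p => growSecond ε φ (true :: p)) := by
        cases k with
        | zero => simp [tableauSum]
        | succ k => simp only [tableauSum, growSecond, hz]; rw [if_pos (by omega), add_zero]
      have hsucc : tableauSum ε (m + 1 + 1) (k + 1) φ =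
          ε ^ (k + 1) * tableauSum ε (m + 1) (k + 1) (fun p => φ (true :: p)) +
            tableauSum ε (m + 1) k (fun p => φ (false :: p)) := by
        rw [tableauSum, if_pos (by omega)]
      rw [key', key, hsucc]
      linear_combination ε * tableauSum ε (m + 1) k (fun p => φ (false :: p)) * hp k

/-- The signed (if `ε = -1`) number of standard tableaux of shape `(m - k, k)`. -/
def tableauCount (ε : R) (m k : ℕ) : R := tableauSum ε m k fun _ => 1

lemma tableauSum_pow_count (ε x : R) (m k s : ℕ) :
    tableauSum ε m k (fun p => x ^ (p.count true + s)) =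
      tableauCount ε m k * x ^ (m - k + s) := by
  induction m generalizing k s with
  | zero => cases k <;> simp [tableauSum, tableauCount]
  | succ m ih =>
    have h1 (k : ℕ) := ih k (s + 1)
    simp only [tableauCount] at ih h1 ⊢
    cases k with
    | zero =>
      simp only [tableauSum, List.count_cons_self, add_assoc, add_comm 1 s, h1]
      congr 2
      omega
    | succ k =>
      simp only [tableauSum, List.count_cons_self, add_assoc, add_comm 1 s, h1]
      simp only [List.count_cons_of_ne Bool.false_ne_true, ih]
      split_ifs with h
      · rw [show m + 1 - (k + 1) + s = m - k + s by omega,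
          show m - (k + 1) + (s + 1) = m - k + s by omega]
        ring
      · rw [zero_mul]

/-- One insertion step applied to the sum over all pairs of tableaux of equal shape. -/
lemma sum_tableauSum_insertSum {ε : R} (hε : ε * ε = 1) (m : ℕ) (φ : List Bool → R) :
    ∑ k ∈ Finset.range (m + 1), ε ^ k * tableauCount ε m k * tableauSum ε m k (insertSum ε φ) =
      ∑ k ∈ Finset.range (m + 2),
        ε ^ k * tableauCount ε (m + 1) k * tableauSum ε (m + 1) k φ := by
  have hp (j : ℕ) : ε ^ j * ε ^ j = 1 := by rw [← mul_pow, hε, one_pow]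
  have hstep (k : ℕ) :
      ε ^ k * tableauCount ε m k * tableauSum ε m k (insertSum ε φ) =
        tableauCount ε m k * tableauSum ε (m + 1) k φ +
          ε ^ (k + 1) * tableauCount ε m k * tableauSum ε (m + 1) (k + 1) φ := by
    rcases lt_or_ge m (2 * k) with h | h
    · simp [tableauCount, tableauSum_eq_zero ε h]
    · have : insertSum ε φ = fun q => growFirst ε φ q + growSecond ε φ q :=
        funext (insertSum_eq ε φ)
      rw [this, tableauSum_add, tableauSum_growFirst hε h, tableauSum_growSecond hε]
      linear_combination tableauCount ε m k * tableauSum ε (m + 1) k φ * hp k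
  have hsucc (k : ℕ) :
      ε ^ (k + 1) * tableauCount ε (m + 1) (k + 1) * tableauSum ε (m + 1) (k + 1) φ =
        tableauCount ε m (k + 1) * tableauSum ε (m + 1) (k + 1) φ +
          ε ^ (k + 1) * tableauCount ε m k * tableauSum ε (m + 1) (k + 1) φ := by
    rcases lt_or_ge (m + 1) (2 * (k + 1)) with h | h
    · simp [tableauSum_eq_zero ε h]
    · have : tableauCount ε (m + 1) (k + 1) =
          ε ^ (k + 1) * tableauCount ε m (k + 1) + tableauCount ε m k := by
        simp only [tableauCount, tableauSum]
        rw [if_pos h]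
      rw [this]
      linear_combination
        tableauCount ε m (k + 1) * tableauSum ε (m + 1) (k + 1) φ * hp (k + 1)
  simp only [hstep, Finset.sum_add_distrib]
  rw [Finset.sum_range_succ' _ (m + 1)]
  simp only [hsucc, Finset.sum_add_distrib]
  rw [Finset.sum_range_succ' (fun k => tableauCount ε m k * tableauSum ε (m + 1) k φ) m,
    Finset.sum_range_succ
      (fun k => tableauCount ε m (k + 1) * tableauSum ε (m + 1) (k + 1) φ) m]
  have h0 : tableauCount ε m (m + 1) = 0 := tableauSum_eq_zero ε (by omega) _
  have h1 : tableauCount ε (m + 1) 0 = tableauCount ε m 0 := rfl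
  simp only [h0, h1]
  ring

end Operators

section SignedCount

variable {R : Type*} [CommRing R]

lemma tableauCount_succ_succ (ε : R) (m k : ℕ) : tableauCount ε (m + 1) (k + 1) =
    if 2 * (k + 1) ≤ m + 1 then ε ^ (k + 1) * tableauCount ε m (k + 1) + tableauCount ε m k
    else 0 := rfl

lemma tableauCount_eq_zero (ε : R) {m k : ℕ} (h : m < 2 * k) : tableauCount ε m k = 0 :=
  tableauSum_eq_zero ε h _

lemma tableauCount_neg_one_odd (n j : ℕ) :
    tableauCount (-1 : R) (2 * n + 1) (2 * j) = tableauCount 1 n j ∧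
      tableauCount (-1 : R) (2 * n + 1) (2 * j + 1) = 0 := by
  induction n generalizing j with
  | zero =>
    refine ⟨?_, tableauCount_eq_zero _ (by omega)⟩
    cases j with
    | zero => simp [tableauCount, tableauSum]
    | succ j => rw [tableauCount_eq_zero _ (by omega), tableauCount_eq_zero _ (by omega)]
  | succ n ih =>
    have hodd (j : ℕ) :
        tableauCount (-1 : R) (2 * n + 2) (2 * j + 1) = tableauCount 1 n j := by
      rw [tableauCount_succ_succ, (ih j).1, (ih j).2]
      split_ifs with h
      · simp
      · rw [tableauCount_eq_zero _ (by omega)]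
    have heven (j : ℕ) (h : 2 * j ≤ n + 1) :
        tableauCount (-1 : R) (2 * n + 2) (2 * j) = tableauCount 1 n j := by
      cases j with
      | zero => exact (ih 0).1
      | succ j =>
        rw [show 2 * (j + 1) = 2 * j + 1 + 1 by ring, tableauCount_succ_succ, (ih j).2,
          if_pos (by omega), show 2 * j + 1 + 1 = 2 * (j + 1) by ring, (ih (j + 1)).1]
        simp [pow_mul]
    rw [show 2 * (n + 1) + 1 = 2 * n + 2 + 1 by ring]
    constructor
    · cases j with
      | zero => exact heven 0 (by omega)
      | succ j =>
        rcases lt_or_ge (n + 1) (2 * (j + 1)) with h | h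
        · rw [tableauCount_eq_zero _ (by omega), tableauCount_eq_zero _ (by omega)]
        · rw [show 2 * (j + 1) = 2 * j + 1 + 1 by ring, tableauCount_succ_succ,
            if_pos (by omega), hodd, show 2 * j + 1 + 1 = 2 * (j + 1) by ring, heven _ h,
            tableauCount_succ_succ, if_pos h]
          simp [pow_mul]
    · rw [tableauCount_succ_succ, hodd]
      split_ifs with h
      · rw [heven j (by omega)]
        simp [pow_succ, pow_mul]
      · rfl

end SignedCount

section Permutations

@[simp] lemma consPerm_zero {m : ℕ} (v : Fin (m + 1)) (σ : Equiv.Perm (Fin m)) :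
    consPerm v σ 0 = v := by
  simp [consPerm]

@[simp] lemma consPerm_succ {m : ℕ} (v : Fin (m + 1)) (σ : Equiv.Perm (Fin m)) (i : Fin m) :
    consPerm v σ i.succ = v.succAbove (σ i) := by
  simp [consPerm]

lemma sign_consPerm {m : ℕ} (v : Fin (m + 1)) (σ : Equiv.Perm (Fin m)) :
    Equiv.Perm.sign (consPerm v σ) = (-1) ^ (v : ℕ) * Equiv.Perm.sign σ := by
  simp [consPerm, Fin.sign_cycleRange]

lemma consPerm_bijective (m : ℕ) :
    Function.Bijective fun x : Fin (m + 1) × Equiv.Perm (Fin m) => consPerm x.1 x.2 := by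
  rw [Fintype.bijective_iff_injective_and_card]
  constructor
  · rintro ⟨v, σ⟩ ⟨w, τ⟩ h
    have hv : v = w := by simpa using congrArg (fun π => π 0) h
    subst hv
    refine Prod.ext rfl (Equiv.ext fun i => ?_)
    simpa using congrArg (fun π => π i.succ) h
  · simp [Fintype.card_perm, Nat.factorial_succ]

/-- `Fin (m + 1) × Perm (Fin m) ≃ Perm (Fin (m + 1))` by `consPerm`. -/
noncomputable def consPermEquiv (m : ℕ) :
    Fin (m + 1) × Equiv.Perm (Fin m) ≃ Equiv.Perm (Fin (m + 1)) :=
  Equiv.ofBijective _ (consPerm_bijective m)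

/-- The word of the insertion tableau of `π`, whose entries are inserted from right to left and
with their order reversed. -/
noncomputable def tableauWord : (m : ℕ) → Equiv.Perm (Fin m) → List Bool
  | 0, _ => []
  | m + 1, π =>
    rowInsert (tableauWord m ((consPermEquiv m).symm π).2) ((consPermEquiv m).symm π).1

lemma tableauWord_consPerm {m : ℕ} (v : Fin (m + 1)) (σ : Equiv.Perm (Fin m)) :
    tableauWord (m + 1) (consPerm v σ) = rowInsert (tableauWord m σ) v := by
  have : (consPermEquiv m).symm (consPerm v σ) = (v, σ) :=
    (consPermEquiv m).symm_apply_apply (v, σ)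
  simp [tableauWord, this]

lemma length_tableauWord {m : ℕ} (π : Equiv.Perm (Fin m)) :
    (tableauWord m π).length = m := by
  induction m with
  | zero => rfl
  | succ m ih =>
    obtain ⟨⟨v, σ⟩, rfl⟩ := (consPerm_bijective m).2 π
    simp only [tableauWord_consPerm]
    rw [length_rowInsert (by rw [ih]; omega), ih]

/-- The values of `π` below `j` appear in increasing order. -/
def IncreasingBelow {m : ℕ} (π : Equiv.Perm (Fin m)) (j : ℕ) : Prop :=
  ∀ a b : Fin m, a < b → (π a : ℕ) < j → (π b : ℕ) < j → π a < π b

/-- `π` has an increasing subsequence of length `c` with all values at least `j`. -/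
def HasIncreasing {m : ℕ} (π : Equiv.Perm (Fin m)) (j c : ℕ) : Prop :=
  ∃ s : Finset (Fin m), (∀ a ∈ s, ∀ b ∈ s, a < b → π a < π b) ∧ (∀ a ∈ s, j ≤ (π a : ℕ)) ∧
    s.card = c

lemma val_succAbove {m : ℕ} (v : Fin (m + 1)) (x : Fin m) :
    (v.succAbove x : ℕ) = if (x : ℕ) < v then (x : ℕ) else x + 1 := by
  simp only [Fin.succAbove, Fin.lt_def, Fin.val_castSucc]
  split_ifs <;> simp

lemma increasingBelow_consPerm {m : ℕ} (v : Fin (m + 1)) (σ : Equiv.Perm (Fin m))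
    (h : IncreasingBelow σ v) (j : ℕ) :
    IncreasingBelow (consPerm v σ) j ↔ j ≤ v ∨ (v : ℕ) = 0 ∧ IncreasingBelow σ (j - 1) := by
  constructor
  · intro H
    rw [or_iff_not_imp_left]
    intro hj
    have hv : (v : ℕ) = 0 := by
      by_contra hv
      have hm : 0 < m := by omega
      have := H 0 (σ.symm ⟨0, hm⟩).succ (Fin.succ_pos _) (by simp; omega)
        (by simp [val_succAbove, Nat.pos_of_ne_zero hv]; omega)
      simp [-Fin.val_fin_lt, Fin.lt_def, val_succAbove, Nat.pos_of_ne_zero hv] at this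
    refine ⟨hv, fun a b hab ha hb => ?_⟩
    have := H a.succ b.succ (by simpa using hab) (by rw [consPerm_succ, val_succAbove]; split_ifs <;> omega)
      (by rw [consPerm_succ, val_succAbove]; split_ifs <;> omega)
    simpa using this
  · intro H a b hab ha hb
    obtain ⟨b, rfl⟩ := Fin.exists_succ_eq.2 (Fin.ne_zero_of_lt hab)
    rcases Fin.eq_zero_or_eq_succ a with rfl | ⟨a, rfl⟩
    · simp [-Fin.val_fin_lt, Fin.lt_def, val_succAbove] at ha hb ⊢
      split_ifs at hb ⊢ <;> omega
    · simp only [consPerm_succ, val_succAbove, Fin.succAbove_lt_succAbove_iff,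
        Fin.succ_lt_succ_iff] at hab ha hb ⊢
      rcases H with H | ⟨H0, H⟩
      · exact h a b hab (by split_ifs at ha <;> omega) (by split_ifs at hb <;> omega)
      · exact H a b hab (by split_ifs at ha <;> omega) (by split_ifs at hb <;> omega)

lemma avoids321_consPerm {m : ℕ} (v : Fin (m + 1)) (σ : Equiv.Perm (Fin m)) :
    Avoids321 (consPerm v σ) ↔ Avoids321 σ ∧ IncreasingBelow σ v := by
  constructor
  · intro H
    constructor
    · rintro ⟨i, j, k, hij, hjk, h1, h2⟩
      exact H ⟨i.succ, j.succ, k.succ, by simpa, by simpa, by simpa, by simpa⟩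
    · intro a b hab ha hb
      by_contra hlt
      have hne : σ b ≠ σ a := fun h => hab.ne' (σ.injective h)
      refine H ⟨0, a.succ, b.succ, Fin.succ_pos _, by simpa, ?_, ?_⟩
      · simpa using lt_of_le_of_ne (not_lt.1 hlt) hne
      · simp [-Fin.val_fin_lt, Fin.lt_def, val_succAbove, ha]
  · rintro ⟨H, h⟩ ⟨i, j, k, hij, hjk, h1, h2⟩
    obtain ⟨j, rfl⟩ := Fin.exists_succ_eq.2 (Fin.ne_zero_of_lt hij)
    obtain ⟨k, rfl⟩ := Fin.exists_succ_eq.2 (Fin.ne_zero_of_lt hjk)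
    rcases Fin.eq_zero_or_eq_succ i with rfl | ⟨i, rfl⟩
    · simp only [consPerm_succ, consPerm_zero, Fin.succAbove_lt_succAbove_iff,
        Fin.succ_lt_succ_iff] at h1 h2 hjk
      have hj : (σ j : ℕ) < v := by
        rw [Fin.lt_def, val_succAbove] at h2
        split_ifs at h2 <;> omega
      exact absurd (h j k hjk hj (lt_trans h1 hj)) (not_lt.2 h1.le)
    · simp only [consPerm_succ, Fin.succAbove_lt_succAbove_iff,
        Fin.succ_lt_succ_iff] at h1 h2 hjk hij
      exact H ⟨i, j, k, hij, hjk, h1, h2⟩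

lemma hasIncreasing_consPerm_of_lt {m : ℕ} (v : Fin (m + 1)) (σ : Equiv.Perm (Fin m))
    {j : ℕ} (hj : (v : ℕ) < j) (c : ℕ) :
    HasIncreasing (consPerm v σ) j c ↔ HasIncreasing σ (j - 1) c := by
  constructor
  · rintro ⟨s, hs, hv, rfl⟩
    have h0 : (0 : Fin (m + 1)) ∉ s := fun h => by simpa [hj.not_ge] using hv 0 h
    have himg : (s.preimage Fin.succ (Fin.succ_injective m).injOn).map (Fin.succEmb m) = s := by
      ext x
      rcases Fin.eq_zero_or_eq_succ x with rfl | ⟨x, rfl⟩ <;> simp [h0, Fin.succ_ne_zero]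
    refine ⟨s.preimage Fin.succ (Fin.succ_injective m).injOn, ?_, ?_, ?_⟩
    · intro a ha b hb hab
      simpa using hs a.succ (by simpa using ha) b.succ (by simpa using hb) (by simpa)
    · intro a ha
      have := hv a.succ (by simpa using ha)
      simp only [consPerm_succ, val_succAbove] at this
      split_ifs at this <;> omega
    · rw [← Finset.card_map (Fin.succEmb m), himg]
  · rintro ⟨s, hs, hv, rfl⟩
    refine ⟨s.map (Fin.succEmb m), ?_, ?_, by simp⟩
    · simpa using hs
    · simp only [Finset.mem_map, Fin.coe_succEmb, forall_exists_index, and_imp]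
      rintro _ a ha rfl
      have := hv a ha
      simp only [consPerm_succ, val_succAbove]
      split_ifs <;> omega

lemma hasIncreasing_consPerm_of_le {m : ℕ} (v : Fin (m + 1)) (σ : Equiv.Perm (Fin m))
    {j : ℕ} (hj : j ≤ v) (c : ℕ) :
    HasIncreasing (consPerm v σ) j c ↔
      HasIncreasing σ j c ∨ ∃ d, c = d + 1 ∧ HasIncreasing σ v d := by
  constructor
  · rintro ⟨s, hs, hv, rfl⟩
    set t := s.preimage Fin.succ (Fin.succ_injective m).injOn with ht
    have hmem (a : Fin m) : a ∈ t ↔ a.succ ∈ s := by simp [ht]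
    have hinc : ∀ a ∈ t, ∀ b ∈ t, a < b → σ a < σ b := by
      intro a ha b hb hab
      simpa using hs a.succ ((hmem a).1 ha) b.succ ((hmem b).1 hb) (by simpa)
    by_cases h0 : (0 : Fin (m + 1)) ∈ s
    · right
      refine ⟨t.card, ?_, t, hinc, ?_, rfl⟩
      · have himg : insert 0 (t.map (Fin.succEmb m)) = s := by
          ext x
          rcases Fin.eq_zero_or_eq_succ x with rfl | ⟨x, rfl⟩ <;>
            simp [h0, Fin.succ_ne_zero, hmem]
        rw [← himg, Finset.card_insert_of_notMem (by simp [Fin.succ_ne_zero]), Finset.card_map]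
      · intro a ha
        have := hs 0 h0 a.succ ((hmem a).1 ha) (Fin.succ_pos a)
        simp only [consPerm_zero, consPerm_succ, Fin.lt_def, val_succAbove] at this
        split_ifs at this <;> omega
    · left
      refine ⟨t, hinc, ?_, ?_⟩
      · intro a ha
        have := hv a.succ ((hmem a).1 ha)
        simp only [consPerm_succ, val_succAbove] at this
        split_ifs at this <;> omega
      · have himg : t.map (Fin.succEmb m) = s := by
          ext x
          rcases Fin.eq_zero_or_eq_succ x with rfl | ⟨x, rfl⟩ <;>
            simp [h0, Fin.succ_ne_zero, hmem]
        rw [← himg, Finset.card_map]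
  · rintro (⟨s, hs, hv, rfl⟩ | ⟨d, rfl, s, hs, hv, rfl⟩)
    · refine ⟨s.map (Fin.succEmb m), by simpa using hs, ?_, by simp⟩
      simp only [Finset.mem_map, Fin.coe_succEmb, forall_exists_index, and_imp]
      rintro _ a ha rfl
      have := hv a ha
      simp only [consPerm_succ, val_succAbove]
      split_ifs <;> omega
    · refine ⟨insert 0 (s.map (Fin.succEmb m)), ?_, ?_, ?_⟩
      · intro a ha b hb hab
        obtain ⟨b, rfl⟩ := Fin.exists_succ_eq.2 (Fin.ne_zero_of_lt hab)
        have hb' : b ∈ s := by simpa [Fin.succ_ne_zero] using hb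
        rcases Fin.eq_zero_or_eq_succ a with rfl | ⟨a, rfl⟩
        · have := hv b hb'
          simp only [consPerm_zero, consPerm_succ, Fin.lt_def, val_succAbove]
          split_ifs <;> omega
        · have ha' : a ∈ s := by simpa [Fin.succ_ne_zero] using ha
          simpa using hs a ha' b hb' (by simpa using hab)
      · intro a ha
        rcases Fin.eq_zero_or_eq_succ a with rfl | ⟨a, rfl⟩
        · simpa using hj
        · have := hv a (by simpa [Fin.succ_ne_zero] using ha)
          simp only [consPerm_succ, val_succAbove]
          split_ifs <;> omega
      · rw [Finset.card_insert_of_notMem (by simp [Fin.succ_ne_zero]), Finset.card_map]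

lemma tableauWord_spec {m : ℕ} (π : Equiv.Perm (Fin m)) (hπ : Avoids321 π) {j : ℕ}
    (hj : j ≤ m) :
    (insertable (tableauWord m π) j ↔ IncreasingBelow π j) ∧
      ∀ c, HasIncreasing π j c ↔ c ≤ ((tableauWord m π).drop j).count true := by
  induction m generalizing j with
  | zero =>
    obtain rfl : j = 0 := by omega
    refine ⟨by simp [insertable, IncreasingBelow], fun c => ?_⟩
    constructor
    · rintro ⟨s, -, -, rfl⟩
      simp [Finset.eq_empty_of_isEmpty s]
    · intro h
      obtain rfl : c = 0 := by simpa [tableauWord] using h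
      exact ⟨∅, by simp⟩
  | succ m ih =>
    obtain ⟨⟨v, σ⟩, rfl⟩ := (consPerm_bijective m).2 π
    simp only [tableauWord_consPerm] at hπ ⊢
    rw [avoids321_consPerm] at hπ
    have hvm : (v : ℕ) ≤ m := by omega
    have hins : insertable (tableauWord m σ) v := (ih σ hπ.1 hvm).1.2 hπ.2
    have hlen : (v : ℕ) ≤ (tableauWord m σ).length := by rwa [length_tableauWord]
    constructor
    · rw [insertable_rowInsert hins, increasingBelow_consPerm v σ hπ.2,
        (ih σ hπ.1 (by omega : j - 1 ≤ m)).1]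
    · intro c
      rcases lt_or_ge (v : ℕ) j with h | h
      · rw [hasIncreasing_consPerm_of_lt v σ h, drop_rowInsert hlen h,
          (ih σ hπ.1 (by omega : j - 1 ≤ m)).2]
      · rw [hasIncreasing_consPerm_of_le v σ h, count_drop_rowInsert hlen hins h,
          (ih σ hπ.1 (by omega : j ≤ m)).2]
        simp only [(ih σ hπ.1 hvm).2, le_max_iff]
        cases c with
        | zero => simp
        | succ c => simp

lemma lis_eq_count {m : ℕ} {π : Equiv.Perm (Fin m)} (hπ : Avoids321 π) :
    lis π = (tableauWord m π).count true := by
  have h := (tableauWord_spec π hπ (Nat.zero_le m)).2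
  have : {k : ℕ | ∃ s : Finset (Fin m),
      (∀ i ∈ s, ∀ j ∈ s, i < j → π i < π j) ∧ s.card = k} =
        Set.Iic ((tableauWord m π).count true) := by
    ext c
    simpa [HasIncreasing] using h c
  rw [lis, this, csSup_Iic]

variable {R : Type*} [CommRing R]

/-- Sum over `321`-avoiding permutations of a function of the insertion tableau, as a sum over
pairs of standard tableaux of the same shape. -/
lemma sum_avoids321 (χ : ℤˣ →* R) (m : ℕ) (φ : List Bool → R) :
    ∑ π ∈ Finset.univ.filter (fun π : Equiv.Perm (Fin m) => Avoids321 π),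
        χ (Equiv.Perm.sign π) * φ (tableauWord m π) =
      ∑ k ∈ Finset.range (m + 1),
        χ (-1) ^ k * tableauCount (χ (-1)) m k * tableauSum (χ (-1)) m k φ := by
  have hε : χ (-1) * χ (-1) = 1 := by rw [← map_mul]; simp
  induction m generalizing φ with
  | zero =>
    have : ∀ π : Equiv.Perm (Fin 0), Avoids321 π := by rintro π ⟨i, -⟩; exact i.elim0
    simp [this, tableauCount, tableauSum, tableauWord]
  | succ m ih =>
    rw [← sum_tableauSum_insertSum hε, ← ih, Finset.sum_filter, Finset.sum_filter,
      ← (consPermEquiv m).sum_comp, Fintype.sum_prod_type_right]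
    refine Finset.sum_congr rfl fun σ _ => ?_
    have hcons (v : Fin (m + 1)) : consPermEquiv m (v, σ) = consPerm v σ := rfl
    simp only [hcons, avoids321_consPerm, tableauWord_consPerm, sign_consPerm]
    split_ifs with hσ
    · rw [insertSum, length_tableauWord, Finset.mul_sum, Finset.sum_range]
      refine Finset.sum_congr rfl fun v _ => ?_
      simp only [hσ, true_and, (tableauWord_spec σ hσ (by omega : (v : ℕ) ≤ m)).1, map_mul,
        map_pow]
      split_ifs <;> ring
    · simp [hσ]

lemma sum_pow_lis (χ : ℤˣ →* R) (m : ℕ) (x : R) :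
    ∑ π ∈ Finset.univ.filter (fun π : Equiv.Perm (Fin m) => Avoids321 π),
        χ (Equiv.Perm.sign π) * x ^ lis π =
      ∑ k ∈ Finset.range (m + 1),
        χ (-1) ^ k * tableauCount (χ (-1)) m k ^ 2 * x ^ (m - k) := by
  rw [Finset.sum_congr rfl fun π hπ => by rw [lis_eq_count (Finset.mem_filter.1 hπ).2],
    sum_avoids321 χ m fun p => x ^ p.count true]
  refine Finset.sum_congr rfl fun k _ => ?_
  have := tableauSum_pow_count (χ (-1)) x m k 0
  simp only [add_zero] at this
  rw [this]
  ring

lemma sum_range_two_mul (f : ℕ → R) (n : ℕ) :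
    ∑ k ∈ Finset.range (2 * n), f k = ∑ j ∈ Finset.range n, (f (2 * j) + f (2 * j + 1)) := by
  induction n with
  | zero => simp
  | succ n ih =>
    rw [Finset.sum_range_succ, ← ih, show 2 * (n + 1) = 2 * n + 1 + 1 by ring,
      Finset.sum_range_succ, Finset.sum_range_succ, add_assoc]

end Permutations

theorem sign_balance_lis_odd (n : ℕ) (hn : 1 ≤ n) :
    ∑ π ∈ Finset.univ.filter (fun π : Equiv.Perm (Fin (2 * n + 1)) => Avoids321 π),
        C ((Equiv.Perm.sign π : ℤ)) * X ^ lis π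
      =
    ∑ π ∈ Finset.univ.filter (fun π : Equiv.Perm (Fin n) => Avoids321 π),
        (X : Polynomial ℤ) ^ (2 * lis π + 1) := by
  have hl := sum_pow_lis ((C : ℤ →+* ℤ[X]).toMonoidHom.comp (Units.coeHom ℤ)) (2 * n + 1) X
  have hr := sum_pow_lis (1 : ℤˣ →* ℤ[X]) n (X ^ 2)
  simp only [MonoidHom.one_apply, one_mul, one_pow] at hr
  have hC : ((C : ℤ →+* ℤ[X]).toMonoidHom.comp (Units.coeHom ℤ)) (-1) = -1 := by simp
  rw [hC] at hl
  simp only [pow_succ (X : ℤ[X]) (2 * _), pow_mul, ← Finset.sum_mul]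
  rw [hr]
  refine hl.trans ?_
  rw [show 2 * n + 1 + 1 = 2 * (n + 1) by ring, sum_range_two_mul, Finset.sum_mul]
  refine Finset.sum_congr rfl fun j hj => ?_
  have hjn : j ≤ n := by simpa [Nat.lt_succ_iff] using hj
  rw [(tableauCount_neg_one_odd n j).1, (tableauCount_neg_one_odd n j).2,
    show 2 * n + 1 - 2 * j = 2 * (n - j) + 1 by omega]
  simp only [pow_mul, pow_succ]
  ring
end

section
/- For all n and k, e(2n+2, 2k+1) − o(2n+2, 2k+1) = −b(n,k)², where b(n,k) = ((2k−n+1)/(n+1))·C(n+1,k+1) is the ballot number. -/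
open scoped Classical
open Polynomial

/-- The ballot number `b(n,k) = ((2k−n+1)/(n+1))·C(n+1,k+1)`. -/
def ballotNum (n k : ℕ) : ℕ := ((2 * k + 1 - n) * Nat.choose (n + 1) (k + 1)) / (n + 1)

/-- `eCount n k` is the number of even 321-avoiding permutations of `{1,…,n}`
whose longest increasing subsequence has length `k`. -/
noncomputable def eCount (n k : ℕ) : ℕ :=
  Nat.card {π : Equiv.Perm (Fin n) // Avoids321 π ∧ lis π = k ∧ Equiv.Perm.sign π = 1}

/-- `oCount n k` is the number of odd 321-avoiding permutations of `{1,…,n}`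
whose longest increasing subsequence has length `k`. -/
noncomputable def oCount (n k : ℕ) : ℕ :=
  Nat.card {π : Equiv.Perm (Fin n) // Avoids321 π ∧ lis π = k ∧ Equiv.Perm.sign π = -1}

namespace TwoRow

/-! ### Sums over Boolean words

A standard Young tableau with at most two rows is encoded by the Boolean word whose `i`-th
letter tells whether the `i`-th entry lies in the first row. -/

/-- The sum of `f` over all Boolean words of length `n`. -/
def wordSum : ℕ → (List Bool → ℤ) → ℤ
  | 0, f => f []
  | n + 1, f => wordSum n (fun l => f (true :: l)) + wordSum n (fun l => f (false :: l))

lemma wordSum_congr {n : ℕ} {f g : List Bool → ℤ} (h : ∀ l, l.length = n → f l = g l) :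
    wordSum n f = wordSum n g := by
  induction n generalizing f g with
  | zero => exact h [] rfl
  | succ n ih =>
    simp only [wordSum]
    rw [ih (fun l hl => h (true :: l) (by simp [hl])),
      ih (fun l hl => h (false :: l) (by simp [hl]))]

lemma wordSum_add (n : ℕ) (f g : List Bool → ℤ) :
    wordSum n (fun l => f l + g l) = wordSum n f + wordSum n g := by
  induction n generalizing f g with
  | zero => rfl
  | succ n ih => simp only [wordSum, ih]; ring

lemma wordSum_mul (n : ℕ) (c : ℤ) (f : List Bool → ℤ) :
    wordSum n (fun l => c * f l) = c * wordSum n f := by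
  induction n generalizing f with
  | zero => rfl
  | succ n ih => simp only [wordSum, ih]; ring

lemma wordSum_neg (n : ℕ) (f : List Bool → ℤ) :
    wordSum n (fun l => -f l) = -wordSum n f := by
  simpa using wordSum_mul n (-1) f

lemma wordSum_zero (n : ℕ) : wordSum n (fun _ => 0) = 0 := by
  simpa using wordSum_mul n 0 (fun _ => 0)

/-! ### Insertion -/

/-- Row insertion of the new entry `d` when it does not bump anything. -/
def extendRow : List Bool → ℕ → Option (List Bool)
  | [], 0 => some [true]
  | [], _ + 1 => none
  | true :: l, 0 => some (true :: true :: l)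
  | false :: l, 0 => some (true :: false :: l)
  | true :: _, _ + 1 => none
  | false :: l, d + 1 => (extendRow l d).map (false :: ·)

@[simp] lemma extendRow_zero (l : List Bool) : extendRow l 0 = some (true :: l) := by
  rcases l with _ | ⟨_ | _, l⟩ <;> rfl

/-- Row insertion of the new entry `d` when it bumps an entry, which has to be the new extreme
entry of the second row. -/
def bumpRow : List Bool → ℕ → Option (List Bool)
  | [], _ => none
  | _ :: _, 0 => none
  | false :: _, _ + 1 => none
  | true :: l, d + 1 => ((extendRow l d).map (false :: ·)).or ((bumpRow l d).map (true :: ·))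

@[simp] lemma bumpRow_zero (l : List Bool) : bumpRow l 0 = none := by
  rcases l with _ | ⟨_ | _, l⟩ <;> rfl

/-- Row insertion of the new entry `d`; undefined if a third row would be needed. -/
def insertRow (l : List Bool) (d : ℕ) : Option (List Bool) :=
  (extendRow l d).or (bumpRow l d)

lemma extendRow_eq_none_or_bumpRow_eq_none (l : List Bool) (d : ℕ) :
    extendRow l d = none ∨ bumpRow l d = none := by
  rcases l with _ | ⟨_ | _, l⟩ <;> rcases d with _ | d <;> simp [extendRow, bumpRow]

lemma elim_or_of_eq_none {a b : Option (List Bool)} (h : a = none ∨ b = none)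
    (φ : List Bool → ℤ) : (a.or b).elim 0 φ = a.elim 0 φ + b.elim 0 φ := by
  rcases a with _ | a <;> rcases b with _ | b <;> simp_all

lemma elim_insertRow (l : List Bool) (d : ℕ) (φ : List Bool → ℤ) :
    (insertRow l d).elim 0 φ = (extendRow l d).elim 0 φ + (bumpRow l d).elim 0 φ :=
  elim_or_of_eq_none (extendRow_eq_none_or_bumpRow_eq_none l d) φ

lemma elim_map_cons (o : Option (List Bool)) (x : Bool) (φ : List Bool → ℤ) :
    (o.map (x :: ·)).elim 0 φ = o.elim 0 (fun l => φ (x :: l)) := by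
  cases o <;> rfl

lemma extendRow_eq_some {l l' : List Bool} {d : ℕ} (h : extendRow l d = some l') :
    ∃ m, l = List.replicate d false ++ m ∧ l' = List.replicate d false ++ true :: m := by
  induction l generalizing d l' with
  | nil => rcases d with _ | d <;> simp_all [extendRow]
  | cons x l ih =>
    rcases d with _ | d
    · simp_all
    · rcases x with _ | _
      · simp only [extendRow, Option.map_eq_some_iff] at h
        obtain ⟨k, hk, rfl⟩ := h
        obtain ⟨m, rfl, rfl⟩ := ih hk
        exact ⟨m, by simp [List.replicate_succ], by simp [List.replicate_succ]⟩
      · simp [extendRow] at h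

lemma bumpRow_eq_some {l l' : List Bool} {d : ℕ} (h : bumpRow l d = some l') :
    ∃ u c m, d = u + 1 + c ∧
      l = List.replicate (u + 1) true ++ (List.replicate c false ++ m) ∧
      l' = List.replicate u true ++ (List.replicate (c + 1) false ++ true :: m) := by
  induction l generalizing d l' with
  | nil => simp [bumpRow] at h
  | cons x l ih =>
    rcases d with _ | d
    · simp at h
    rcases x with _ | _
    · simp [bumpRow] at h
    · simp only [bumpRow, Option.or_eq_some_iff, Option.map_eq_some_iff] at h
      rcases h with ⟨k, hk, rfl⟩ | ⟨-, k, hk, rfl⟩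
      · obtain ⟨m, rfl, rfl⟩ := extendRow_eq_some hk
        exact ⟨0, d, m, by omega, by simp, by simp [List.replicate_succ]⟩
      · obtain ⟨u, c, m, rfl, rfl, rfl⟩ := ih hk
        exact ⟨u + 1, c, m, by omega, by simp [List.replicate_succ],
          by simp [List.replicate_succ]⟩

lemma true_mem_take_of_extendRow_eq_none {l : List Bool} {d : ℕ} (hd : d ≤ l.length)
    (h : extendRow l d = none) : true ∈ l.take d := by
  induction l generalizing d with
  | nil => simp_all
  | cons x l ih =>
    rcases d with _ | d
    · simp at h
    rcases x with _ | _
    · simp only [extendRow, Option.map_eq_none_iff] at h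
      simpa using ih (by simpa using hd) h
    · simp

lemma sublist_take_of_insertRow_eq_none {l : List Bool} {d : ℕ} (hd : d ≤ l.length)
    (h : insertRow l d = none) : [false, true].Sublist (l.take d) := by
  induction l generalizing d with
  | nil => simp_all [insertRow]
  | cons x l ih =>
    rcases d with _ | d
    · simp [insertRow] at h
    simp only [insertRow, Option.or_eq_none_iff] at h
    rcases x with _ | _
    · simp only [extendRow, Option.map_eq_none_iff] at h
      have := true_mem_take_of_extendRow_eq_none (by simpa using hd) h.1
      simpa using this
    · simp only [bumpRow, Option.or_eq_none_iff, Option.map_eq_none_iff] at h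
      rw [List.take_succ_cons]
      exact (ih (by simpa using hd) (by simpa [insertRow] using h.2)).cons _

lemma length_of_insertRow_eq_some {l l' : List Bool} {d : ℕ} (h : insertRow l d = some l') :
    l'.length = l.length + 1 := by
  rcases Option.or_eq_some_iff.1 h with h | ⟨-, h⟩
  · obtain ⟨m, rfl, rfl⟩ := extendRow_eq_some h
    simp; omega
  · obtain ⟨u, c, m, rfl, rfl, rfl⟩ := bumpRow_eq_some h
    simp; omega

lemma not_sublist_of_initial_segment {u c : ℕ} {l : List Bool}
    (h : l <+: List.replicate u true ++ List.replicate c false) :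
    ¬ [false, true].Sublist l := by
  intro hl
  have hp : (List.replicate u true ++ List.replicate c false).Pairwise
      (fun a b => a = true ∨ b = false) := by
    simp +contextual [List.pairwise_append, List.pairwise_replicate, List.mem_replicate]
  simpa using hp.sublist (hl.trans h.sublist)

lemma not_sublist_take_of_insertRow_eq_some {l l' : List Bool} {d : ℕ}
    (h : insertRow l d = some l') : ¬ [false, true].Sublist (l.take d) := by
  rcases Option.or_eq_some_iff.1 h with h | ⟨-, h⟩
  · obtain ⟨m, rfl, -⟩ := extendRow_eq_some h
    apply not_sublist_of_initial_segment (u := 0) (c := d)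
    simp
  · obtain ⟨u, c, m, rfl, rfl, -⟩ := bumpRow_eq_some h
    apply not_sublist_of_initial_segment (u := u + 1) (c := c)
    rw [← List.append_assoc, List.take_append_of_le_length (by simp)]
    exact ⟨_, List.take_append_drop _ _⟩

/-- How the pattern of a second-row letter before a first-row letter evolves under insertion. -/
lemma sublist_take_of_insertRow {l l' : List Bool} {d : ℕ} (h : insertRow l d = some l')
    (w : ℕ) : [false, true].Sublist (l'.take w) ↔
      d < w ∧ (0 < d ∨ [false, true].Sublist (l.take (w - 1))) := by
  rcases Nat.eq_zero_or_pos d with rfl | hd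
  · have : l' = true :: l := by simpa [insertRow, eq_comm] using h
    subst this
    rcases w with _ | w
    · simp
    · simp [List.sublist_cons_iff (a := true)]
  simp only [hd, true_or, and_true]
  have key : ∃ u c m, d = u + c ∧ 0 < c ∧
      l' = (List.replicate u true ++ List.replicate c false) ++ true :: m := by
    rcases Option.or_eq_some_iff.1 h with h | ⟨-, h⟩
    · obtain ⟨m, -, rfl⟩ := extendRow_eq_some h
      exact ⟨0, d, m, by simp, hd, by simp⟩
    · obtain ⟨u, c, m, rfl, -, rfl⟩ := bumpRow_eq_some h
      exact ⟨u, c + 1, m, by omega, by omega, by simp⟩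
  obtain ⟨u, c, m, rfl, hc, rfl⟩ := key
  constructor
  · intro hs
    by_contra! hw
    refine not_sublist_of_initial_segment (u := u) (c := c) ?_ hs
    rw [List.take_append_of_le_length (by simpa using hw)]
    exact ⟨_, List.take_append_drop _ _⟩
  · intro hw
    obtain ⟨e, rfl⟩ := Nat.exists_eq_add_of_lt hw
    have h1 : [false].Sublist (List.replicate u true ++ List.replicate c false) := by
      rw [List.singleton_sublist]
      simp; omega
    have h2 : [true].Sublist (List.take (e + 1) (true :: m)) := by simp
    rw [List.take_append, List.take_of_length_le (by simp; omega),
      show u + c + e + 1 - (List.replicate u true ++ List.replicate c false).length = e + 1 by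
        simp; omega]
    exact h1.append h2

/-- The numbers of first-row letters beyond `w` after an insertion. -/
lemma count_drop_of_insertRow {l l' : List Bool} {d : ℕ} (h : insertRow l d = some l') (w : ℕ) :
    (l'.drop w).count true =
      if w ≤ d then max ((l.drop w).count true) ((l.drop d).count true + 1)
      else (l.drop (w - 1)).count true := by
  rcases Option.or_eq_some_iff.1 h with h | ⟨-, h⟩
  · obtain ⟨m, rfl, rfl⟩ := extendRow_eq_some h
    split_ifs with hw
    · obtain ⟨e, rfl⟩ := Nat.exists_eq_add_of_le hw
      simp [List.drop_append, List.count_replicate]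
    · obtain ⟨e, rfl⟩ := Nat.exists_eq_add_of_lt (not_le.1 hw)
      simp [List.drop_append, List.count_replicate, show d + e + 1 - d = e + 1 by omega]
  · obtain ⟨u, c, m, rfl, rfl, rfl⟩ := bumpRow_eq_some h
    split_ifs with hw
    · have h0 : w - u - (c + 1) = 0 := by omega
      have h1 : w - (u + 1) - c = 0 := by omega
      simp [List.drop_append, List.count_replicate, h0, h1]
      omega
    · obtain ⟨e, rfl⟩ := Nat.exists_eq_add_of_lt (not_le.1 hw)
      have h0 : u + 1 + c + e + 1 - u - (c + 1) = e + 1 := by omega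
      have h1 : u + 1 + c + e - (u + 1) - c = e := by omega
      have h2 : u - (u + 1 + c + e + 1) = 0 := by omega
      have h3 : u + 1 - (u + 1 + c + e) = 0 := by omega
      simp [List.drop_append, List.count_replicate, h0, h1, h2, h3]

/-! ### The signed transfer operator -/

/-- The signed sum of `f` over the words from which `l` arises by a non-bumping insertion. -/
def extendPull (f : List Bool → ℤ) : List Bool → ℤ
  | [] => 0
  | true :: l => f l
  | false :: l => -extendPull (fun k => f (false :: k)) l

/-- The signed sum of `f` over the words from which `l` arises by a bumping insertion. -/
def bumpPull (f : List Bool → ℤ) : List Bool → ℤ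
  | [] => 0
  | true :: l => -bumpPull (fun k => f (true :: k)) l
  | false :: l => -extendPull (fun k => f (true :: k)) l

lemma wordSum_extendPull (n : ℕ) (f φ : List Bool → ℤ) :
    wordSum n (fun l => f l *
      ∑ v ∈ Finset.range (n + 1), (-1) ^ v * (extendRow l v).elim 0 φ) =
    wordSum (n + 1) (fun l => extendPull f l * φ l) := by
  induction n generalizing f φ with
  | zero => simp [wordSum, extendPull, extendRow]
  | succ n ih =>
    have h1 : ∀ l : List Bool, f l *
        ∑ v ∈ Finset.range (n + 1 + 1), (-1) ^ v * (extendRow l v).elim 0 φ =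
        f l * φ (true :: l) + f l *
        ∑ v ∈ Finset.range (n + 1), (-1) ^ (v + 1) * (extendRow l (v + 1)).elim 0 φ := by
      intro l
      rw [Finset.sum_range_succ']
      simp; ring
    simp only [h1]
    rw [wordSum_add]
    conv_rhs => rw [wordSum]
    simp only [extendPull]
    congr 1
    rw [wordSum]
    simp only [extendRow, elim_map_cons, Option.elim_none, mul_zero, Finset.sum_const_zero,
      wordSum_zero, zero_add, pow_succ, mul_neg, mul_one, neg_mul, Finset.sum_neg_distrib,
      wordSum_neg]
    rw [ih (fun k => f (false :: k)) (fun k => φ (false :: k))]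

lemma wordSum_bumpPull (n : ℕ) (f φ : List Bool → ℤ) :
    wordSum n (fun l => f l *
      ∑ v ∈ Finset.range (n + 1), (-1) ^ v * (bumpRow l v).elim 0 φ) =
    wordSum (n + 1) (fun l => bumpPull f l * φ l) := by
  induction n generalizing f φ with
  | zero => simp [wordSum, bumpPull, extendPull, bumpRow]
  | succ n ih =>
    have h1 : ∀ l : List Bool, f l *
        ∑ v ∈ Finset.range (n + 1 + 1), (-1) ^ v * (bumpRow l v).elim 0 φ =
        f l *
        ∑ v ∈ Finset.range (n + 1), (-1) ^ (v + 1) * (bumpRow l (v + 1)).elim 0 φ := by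
      intro l
      rw [Finset.sum_range_succ']
      simp
    have h2 : ∀ (l : List Bool) (v : ℕ), (bumpRow (true :: l) (v + 1)).elim 0 φ =
        (extendRow l v).elim 0 (fun k => φ (false :: k)) +
        (bumpRow l v).elim 0 (fun k => φ (true :: k)) := by
      intro l v
      rw [bumpRow, elim_or_of_eq_none, elim_map_cons, elim_map_cons]
      simpa using extendRow_eq_none_or_bumpRow_eq_none l v
    simp only [h1]
    rw [wordSum]
    conv_rhs => rw [wordSum]
    simp only [h2]
    simp only [bumpRow, bumpPull, Option.elim_none, mul_zero, Finset.sum_const_zero,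
      wordSum_zero, add_zero, pow_succ, mul_neg, mul_one, neg_mul, Finset.sum_neg_distrib,
      wordSum_neg, mul_add, Finset.sum_add_distrib, wordSum_add]
    rw [wordSum_extendPull, ih (fun k => f (true :: k)) (fun k => φ (true :: k))]
    ring

lemma wordSum_insertRow (n : ℕ) (f φ : List Bool → ℤ) :
    wordSum n (fun l => f l *
      ∑ v ∈ Finset.range (n + 1), (-1) ^ v * (insertRow l v).elim 0 φ) =
    wordSum (n + 1) (fun l => (extendPull f l + bumpPull f l) * φ l) := by
  simp only [elim_insertRow, mul_add, Finset.sum_add_distrib, wordSum_add, add_mul,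
    wordSum_extendPull, wordSum_bumpPull]

/-! ### Signs of two-row tableaux -/

/-- The sign of a two-row standard Young tableau, and zero if the word is not a ballot word. -/
def tableauSign : List Bool → ℤ
  | [] => 1
  | true :: l => (-1) ^ l.count false * tableauSign l
  | false :: l => if l.count false < l.count true then tableauSign l else 0

/-- The sum of the signs of the standard Young tableaux of shape `(a, b)`. -/
def signSum : ℕ → ℕ → ℤ
  | 0, 0 => 1
  | 0, _ + 1 => 0
  | a + 1, 0 => signSum a 0
  | a + 1, b + 1 => (-1) ^ (b + 1) * signSum a (b + 1) + if b < a + 1 then signSum (a + 1) b else 0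

lemma signSum_eq_zero {a b : ℕ} (h : a < b) : signSum a b = 0 := by
  induction a generalizing b with
  | zero => obtain ⟨b, rfl⟩ := Nat.exists_eq_add_of_lt h; simp [signSum]
  | succ a ih =>
    obtain ⟨b, rfl⟩ : ∃ c, b = c + 1 := ⟨b - 1, by omega⟩
    rw [signSum, ih (by omega), if_neg (by omega)]; simp

lemma tableauSign_eq_zero {l : List Bool} (h : l.count true < l.count false) :
    tableauSign l = 0 := by
  induction l with
  | nil => simp at h
  | cons x l ih =>
    rcases x with _ | _
    · simp only [List.count_cons_self, tableauSign] at h ⊢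
      rw [if_neg]
      simp at h
      omega
    · simp at h
      rw [tableauSign, ih (by omega), mul_zero]

lemma wordSum_tableauSign (n a b : ℕ) (h : a + b = n) :
    wordSum n (fun l => if l.count true = a then tableauSign l else 0) = signSum a b := by
  induction n generalizing a b with
  | zero =>
    obtain ⟨rfl, rfl⟩ : a = 0 ∧ b = 0 := by omega
    simp [wordSum, signSum, tableauSign]
  | succ n ih =>
    have hlen : ∀ l : List Bool, l.length = l.count true + l.count false := fun l => by
      rw [add_comm, List.count_false_add_count_true]
    have h1 : wordSum n (fun l => if (true :: l).count true = a then tableauSign (true :: l) else 0)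
        = (-1) ^ b * if a = 0 then 0 else signSum (a - 1) b := by
      rcases a with _ | a
      · rw [if_pos rfl, mul_zero]
        refine (wordSum_congr fun l _ => if_neg ?_).trans (wordSum_zero n)
        rw [List.count_cons_self]; omega
      · simp only [Nat.add_sub_cancel, Nat.succ_ne_zero, if_false]
        rw [← ih a b (by omega), ← wordSum_mul]
        refine wordSum_congr fun l hl => ?_
        have := hlen l
        by_cases hc : l.count true = a
        · rw [List.count_cons_self, if_pos (by omega), if_pos hc, tableauSign,
            show l.count false = b by omega]
        · rw [List.count_cons_self, if_neg (by omega), if_neg hc, mul_zero]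
    have h2 : wordSum n (fun l => if (false :: l).count true = a then tableauSign (false :: l)
        else 0) = if b = 0 then 0 else if b - 1 < a then signSum a (b - 1) else 0 := by
      rcases b with _ | b
      · rw [if_pos rfl]
        refine (wordSum_congr fun l hl => if_neg ?_).trans (wordSum_zero n)
        have := hlen l
        rw [List.count_cons_of_ne (by decide)]; omega
      · simp only [Nat.add_sub_cancel, Nat.succ_ne_zero, if_false]
        split_ifs with hba
        · rw [← ih a b (by omega)]
          refine wordSum_congr fun l hl => ?_
          have := hlen l
          by_cases hc : l.count true = a
          · simp [hc, tableauSign, show l.count false = b by omega, hba]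
          · simp [hc]
        · refine (wordSum_congr fun l hl => ?_).trans (wordSum_zero n)
          have := hlen l
          by_cases hc : l.count true = a
          · simp [hc, tableauSign, show l.count false = b by omega, hba]
          · simp [hc]
    rw [wordSum, h1, h2]
    rcases a with _ | a <;> rcases b with _ | b <;>
      first | omega | simp [signSum]

/-- The sign of a tableau times a function of its shape. -/
def shapeWeight (h : ℕ → ℕ → ℤ) (l : List Bool) : ℤ :=
  tableauSign l * h (l.count true) (l.count false)

lemma shapeWeight_true_cons (h : ℕ → ℕ → ℤ) :
    (fun l => shapeWeight h (true :: l)) = shapeWeight fun a b => (-1) ^ b * h (a + 1) b := by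
  funext l
  simp [shapeWeight, tableauSign]
  ring

lemma shapeWeight_false_cons (h : ℕ → ℕ → ℤ) :
    (fun l => shapeWeight h (false :: l)) =
      shapeWeight fun a b => if b < a then h a (b + 1) else 0 := by
  funext l
  simp [shapeWeight, tableauSign]

lemma neg_one_pow_mul_self (b : ℕ) : (-1 : ℤ) ^ b * (-1) ^ b = 1 := by
  rw [← mul_pow]; simp

lemma extendPull_shapeWeight (h : ℕ → ℕ → ℤ) (l : List Bool) :
    extendPull (shapeWeight h) l =
      if l.count false < l.count true then
        tableauSign l * ((-1) ^ l.count false * h (l.count true - 1) (l.count false)) else 0 := by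
  induction l generalizing h with
  | nil => simp [extendPull]
  | cons x l ih =>
    rcases x with _ | _
    · rw [extendPull, shapeWeight_false_cons, ih]
      simp only [tableauSign, List.count_cons_self, ne_eq, Bool.false_eq_true, not_false_eq_true,
        List.count_cons_of_ne]
      split_ifs <;> first | omega | simp [pow_succ]
    · simp only [extendPull, shapeWeight, tableauSign, List.count_cons_self, ne_eq,
        Bool.true_eq_false, not_false_eq_true, List.count_cons_of_ne, Nat.add_sub_cancel]
      split_ifs with hc
      · linear_combination (-tableauSign l * h (l.count true) (l.count false)) *
          neg_one_pow_mul_self (l.count false)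
      · rw [tableauSign_eq_zero (by omega), zero_mul]

lemma bumpPull_shapeWeight (h : ℕ → ℕ → ℤ) (l : List Bool) :
    bumpPull (shapeWeight h) l =
      if l.count false = 0 then 0 else
        -(tableauSign l * h (l.count true) (l.count false - 1)) := by
  induction l generalizing h with
  | nil => simp [bumpPull]
  | cons x l ih =>
    rcases x with _ | _
    · rw [bumpPull, shapeWeight_true_cons, extendPull_shapeWeight]
      simp only [tableauSign, List.count_cons_self, ne_eq, Bool.false_eq_true, not_false_eq_true,
        List.count_cons_of_ne, Nat.add_sub_cancel, Nat.succ_ne_zero, if_false]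
      split_ifs with hc
      · rw [Nat.sub_add_cancel (by omega)]
        linear_combination (-tableauSign l * h (l.count true) (l.count false)) *
          neg_one_pow_mul_self (l.count false)
      · simp
    · rw [bumpPull, shapeWeight_true_cons, ih]
      simp only [tableauSign, List.count_cons_self, ne_eq, Bool.true_eq_false, not_false_eq_true,
        List.count_cons_of_ne]
      split_ifs with hc
      · simp
      · obtain ⟨b, hb⟩ := Nat.exists_eq_succ_of_ne_zero hc
        simp only [hb, Nat.succ_eq_add_one, Nat.add_sub_cancel, pow_succ]
        ring

/-- The signed number of permutations with a given insertion tableau. -/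
def signedWeight : List Bool → ℤ :=
  shapeWeight fun a b => (-1) ^ b * signSum a b

lemma extendPull_add_bumpPull_signedWeight {l : List Bool} (hl : l ≠ []) :
    extendPull signedWeight l + bumpPull signedWeight l = signedWeight l := by
  rw [signedWeight, extendPull_shapeWeight, bumpPull_shapeWeight, shapeWeight]
  by_cases hc : l.count true < l.count false
  · simp [tableauSign_eq_zero hc]
  have h0 : l.count true ≠ 0 := by
    intro h0
    rcases l with _ | ⟨_ | _, l⟩ <;> simp at h0 hc hl
    omega
  obtain ⟨a, ha⟩ := Nat.exists_eq_succ_of_ne_zero h0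
  rw [ha] at hc ⊢
  generalize l.count false = b at *
  rcases b with _ | b
  · simp [signSum]
  · simp only [Nat.succ_eq_add_one, signSum, Nat.add_sub_cancel, Nat.succ_ne_zero, if_false]
    rw [if_pos (show b < a + 1 by omega)]
    split_ifs with hab
    · simp only [pow_succ]
      ring
    · rw [signSum_eq_zero (show a < b + 1 by omega)]
      simp only [pow_succ]
      ring

/-! ### The signed number of standard Young tableaux -/

lemma signSum_zero_right (a : ℕ) : signSum a 0 = 1 := by
  induction a with
  | zero => rw [signSum]
  | succ a ih => rw [signSum, ih]

lemma signSum_parity (i : ℕ) :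
    (∀ j, signSum (2 * i) (2 * j + 1) = 0) ∧
    (∀ j, signSum (2 * i + 1) (2 * j + 1) = signSum (2 * i + 1) (2 * j)) ∧
    (∀ j ≤ i, signSum (2 * i + 2) (2 * j) = signSum (2 * i + 1) (2 * j)) := by
  have odd_odd : ∀ i, (∀ j, signSum (2 * i) (2 * j + 1) = 0) →
      ∀ j, signSum (2 * i + 1) (2 * j + 1) = signSum (2 * i + 1) (2 * j) := by
    intro i h j
    rw [signSum, h, mul_zero, zero_add]
    split_ifs with hj
    · rfl
    · exact (signSum_eq_zero (by omega)).symm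
  have even_even : ∀ i, (∀ j, signSum (2 * i) (2 * j + 1) = 0) →
      ∀ j ≤ i, signSum (2 * i + 2) (2 * j) = signSum (2 * i + 1) (2 * j) := by
    intro i h j hj
    induction j with
    | zero => rw [mul_zero, signSum]
    | succ j ih =>
      have h1 : signSum (2 * i + 2) (2 * j + 1) = 0 := by
        rw [signSum, ih (by omega), odd_odd i h, if_pos (by omega), pow_succ, pow_mul]
        simp
      rw [show 2 * (j + 1) = 2 * j + 1 + 1 by ring, signSum, h1, if_pos (by omega),
        show 2 * j + 1 + 1 = 2 * (j + 1) by ring, pow_mul]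
      simp
  have even_odd : ∀ j, signSum (2 * i) (2 * j + 1) = 0 := by
    induction i with
    | zero => intro j; rw [mul_zero, signSum]
    | succ i ih =>
      intro j
      rw [show 2 * (i + 1) = 2 * i + 1 + 1 by ring, signSum, odd_odd i ih, pow_succ, pow_mul]
      split_ifs with hj
      · rw [even_even i ih j (by omega)]; simp
      · rw [signSum_eq_zero (by omega)]; simp
  exact ⟨even_odd, odd_odd i even_odd, even_even i even_odd⟩

lemma signSum_odd_even_succ {i j : ℕ} (h : j ≤ i) :
    signSum (2 * (i + 1) + 1) (2 * (j + 1)) =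
      signSum (2 * i + 1) (2 * (j + 1)) + signSum (2 * (i + 1) + 1) (2 * j) := by
  have h1 : signSum (2 * i + 2) (2 * (j + 1)) = signSum (2 * i + 1) (2 * (j + 1)) := by
    rcases Nat.lt_or_eq_of_le h with h | rfl
    · exact (signSum_parity i).2.2 _ h
    · rw [show 2 * (j + 1) = 2 * j + 1 + 1 by ring, signSum,
        show signSum (2 * j + 1 + 1) (2 * j + 1) = 0 from (signSum_parity (j + 1)).1 j,
        signSum_eq_zero (show 2 * j + 1 < 2 * j + 1 + 1 by omega)]
      simp
  rw [← (signSum_parity (i + 1)).2.1 j, ← h1, show 2 * (j + 1) = 2 * j + 1 + 1 by ring,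
    show 2 * (i + 1) = 2 * i + 1 + 1 by ring, signSum, if_pos (by omega),
    show 2 * j + 1 + 1 = 2 * (j + 1) by ring, pow_mul]
  simp

lemma signSum_odd_even (i j : ℕ) (h : j ≤ i + 1) :
    signSum (2 * i + 1) (2 * j) = (i + j).choose i - ((i + j).choose (i + 1) : ℤ) := by
  induction i generalizing j with
  | zero =>
    obtain rfl | rfl : j = 0 ∨ j = 1 := by omega
    · simp [signSum]
    · rw [signSum_eq_zero (by omega)]; simp
  | succ i ih =>
    induction j with
    | zero => rw [mul_zero, signSum_zero_right]; simp
    | succ j ihj =>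
      rcases Nat.lt_or_eq_of_le h with h | h
      · rw [signSum_odd_even_succ (by omega), ih (j + 1) (by omega), ihj (by omega),
          show i + 1 + (j + 1) = i + j + 1 + 1 by ring, show i + (j + 1) = i + j + 1 by ring,
          show i + 1 + j = i + j + 1 by ring, Nat.choose_succ_succ (i + j + 1) i,
          Nat.choose_succ_succ (i + j + 1) (i + 1)]
        push_cast
        ring
      · obtain rfl : j = i + 1 := by omega
        rw [signSum_eq_zero (by omega),
          Nat.choose_symm_of_eq_add (show i + 1 + (i + 1 + 1) = (i + 1) + (i + 1 + 1) by rfl)]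
        simp

lemma ballotNum_eq_signSum {i j : ℕ} (h : j ≤ i) :
    (ballotNum (i + j) i : ℤ) = signSum (2 * i + 1) (2 * j + 1) := by
  rw [(signSum_parity i).2.1, signSum_odd_even i j (by omega)]
  have h1 := Nat.choose_succ_right_eq (i + j) i
  rw [Nat.add_sub_cancel_left] at h1
  have hle : (i + j).choose (i + 1) ≤ (i + j).choose i := by
    refine Nat.le_of_mul_le_mul_right (c := i + 1) ?_ (by omega)
    rw [h1]
    exact Nat.mul_le_mul_left _ (by omega)
  rw [← Nat.cast_sub hle, Nat.cast_inj, ballotNum]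
  refine Nat.div_eq_of_eq_mul_right (by omega) ?_
  rw [Nat.choose_succ_succ]
  zify [hle, show i + j ≤ 2 * i + 1 by omega] at h1 ⊢
  linear_combination 2 * h1

lemma ballotNum_eq_zero {n k : ℕ} (h : 2 * k + 1 ≤ n ∨ n < k) : ballotNum n k = 0 := by
  rcases h with h | h
  · simp [ballotNum, Nat.sub_eq_zero_of_le h]
  · simp [ballotNum, Nat.choose_eq_zero_of_lt (Nat.succ_lt_succ h)]

lemma wordSum_signedWeight {a b n : ℕ} (h : a + b = n) :
    wordSum n (fun l => signedWeight l * if l.count true = a then 1 else 0) =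
      (-1) ^ b * signSum a b ^ 2 := by
  rw [sq, ← mul_assoc]
  nth_rewrite 2 [← wordSum_tableauSign n a b h]
  rw [← wordSum_mul]
  refine wordSum_congr fun l hl => ?_
  have := List.count_false_add_count_true l
  split_ifs with hc
  · rw [signedWeight, shapeWeight, hc, show l.count false = b by omega]
    ring
  · simp

lemma wordSum_signedWeight_eq_zero {a n : ℕ} (h : n < a) :
    wordSum n (fun l => signedWeight l * if l.count true = a then 1 else 0) = 0 := by
  refine (wordSum_congr fun l hl => ?_).trans (wordSum_zero n)
  have := List.count_false_add_count_true l
  rw [if_neg (by omega), mul_zero]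

/-! ### Permutations, built by prepending values -/

open Equiv Equiv.Perm

/-- The permutation with values `v, v.succAbove (π 0), v.succAbove (π 1), …`. -/
def consPerm {n : ℕ} (p : Fin (n + 1) × Perm (Fin n)) : Perm (Fin (n + 1)) :=
  p.1.cycleRange.symm * decomposeFin.symm (0, p.2)

@[simp] lemma consPerm_zero {n : ℕ} (v : Fin (n + 1)) (π : Perm (Fin n)) :
    consPerm (v, π) 0 = v := by
  simp [consPerm]

@[simp] lemma consPerm_succ {n : ℕ} (v : Fin (n + 1)) (π : Perm (Fin n)) (i : Fin n) :
    consPerm (v, π) i.succ = v.succAbove (π i) := by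
  simp [consPerm]

lemma sign_consPerm {n : ℕ} (p : Fin (n + 1) × Perm (Fin n)) :
    (sign (consPerm p) : ℤ) = (-1) ^ (p.1 : ℕ) * sign p.2 := by
  simp [consPerm, Fin.sign_cycleRange]

lemma consPerm_bijective (n : ℕ) :
    Function.Bijective (consPerm : Fin (n + 1) × Perm (Fin n) → Perm (Fin (n + 1))) := by
  rw [Fintype.bijective_iff_injective_and_card]
  refine ⟨?_, by simp [Fintype.card_perm, Nat.factorial_succ]⟩
  rintro ⟨v, π⟩ ⟨v', π'⟩ h
  obtain rfl : v = v' := by simpa using DFunLike.congr_fun h 0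
  refine Prod.ext rfl (Equiv.ext fun i => ?_)
  simpa using DFunLike.congr_fun h i.succ

/-- Prepending a value, as an equivalence. -/
noncomputable def consEquiv (n : ℕ) : Fin (n + 1) × Perm (Fin n) ≃ Perm (Fin (n + 1)) :=
  Equiv.ofBijective consPerm (consPerm_bijective n)

/-- The word of the insertion tableau of the reversed sequence of values of a permutation,
defined when the tableau has at most two rows. -/
noncomputable def permWord : (n : ℕ) → Perm (Fin n) → Option (List Bool)
  | 0, _ => some []
  | n + 1, π => (permWord n ((consEquiv n).symm π).2).bind
      fun l => insertRow l ((consEquiv n).symm π).1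

lemma permWord_consPerm {n : ℕ} (v : Fin (n + 1)) (π : Perm (Fin n)) :
    permWord (n + 1) (consPerm (v, π)) = (permWord n π).bind fun l => insertRow l v := by
  have : (consEquiv n).symm (consPerm (v, π)) = (v, π) := (consEquiv n).symm_apply_apply (v, π)
  rw [permWord, this]

lemma sum_sign_permWord (n : ℕ) (φ : List Bool → ℤ) :
    ∑ π : Perm (Fin n), (sign π : ℤ) * (permWord n π).elim 0 φ =
      wordSum n (fun l => signedWeight l * φ l) := by
  induction n generalizing φ with
  | zero => simp [permWord, wordSum, signedWeight, shapeWeight, tableauSign, signSum]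
  | succ n ih =>
    rw [← (consEquiv n).sum_comp, Fintype.sum_prod_type_right]
    have h1 : ∀ π : Perm (Fin n), ∑ v : Fin (n + 1), (sign (consEquiv n (v, π)) : ℤ) *
        (permWord (n + 1) (consEquiv n (v, π))).elim 0 φ =
        (sign π : ℤ) * (permWord n π).elim 0 fun l =>
          ∑ v ∈ Finset.range (n + 1), (-1) ^ v * (insertRow l v).elim 0 φ := by
      intro π
      simp only [consEquiv, Equiv.ofBijective_apply, sign_consPerm, permWord_consPerm]
      rcases permWord n π with _ | l
      · simp
      · simp only [Option.bind_some, Option.elim_some, Finset.sum_range, Finset.mul_sum]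
        exact Finset.sum_congr rfl fun v _ => by ring
    simp only [h1]
    rw [ih, wordSum_insertRow]
    refine wordSum_congr fun l hl => ?_
    rw [extendPull_add_bumpPull_signedWeight]
    rintro rfl
    simp at hl

/-- `π` has an inversion whose larger value is less than `w`. -/
def HasInversionBelow {n : ℕ} (π : Perm (Fin n)) (w : ℕ) : Prop :=
  ∃ i j, i < j ∧ π j < π i ∧ (π i : ℕ) < w

/-- `π` has an increasing subsequence of length `k` all of whose values are at least `w`. -/
def HasIncreasingFrom {n : ℕ} (π : Perm (Fin n)) (w k : ℕ) : Prop :=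
  ∃ s : Finset (Fin n), (∀ i ∈ s, ∀ j ∈ s, i < j → π i < π j) ∧ (∀ i ∈ s, w ≤ (π i : ℕ)) ∧
    s.card = k

lemma val_succAbove {n : ℕ} (v : Fin (n + 1)) (x : Fin n) :
    (v.succAbove x : ℕ) = if (x : ℕ) < v then (x : ℕ) else x + 1 := by
  simp only [Fin.succAbove, Fin.lt_def, Fin.val_castSucc]
  split_ifs <;> simp

lemma avoids321_consPerm {n : ℕ} (v : Fin (n + 1)) (π : Perm (Fin n)) :
    Avoids321 (consPerm (v, π)) ↔ Avoids321 π ∧ ¬ HasInversionBelow π v := by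
  have key : (∃ i j k : Fin (n + 1), i < j ∧ j < k ∧ consPerm (v, π) k < consPerm (v, π) j ∧
      consPerm (v, π) j < consPerm (v, π) i) ↔ HasInversionBelow π v ∨
      ∃ i j k : Fin n, i < j ∧ j < k ∧ π k < π j ∧ π j < π i := by
    simp only [Fin.exists_fin_succ, Fin.succ_lt_succ_iff, consPerm_zero, consPerm_succ,
      Fin.succAbove_lt_succAbove_iff, Fin.succ_pos, Fin.not_lt_zero, false_and,
      and_false, exists_false, false_or, true_and, HasInversionBelow]
    simp only [Fin.lt_def (a := v.succAbove _), val_succAbove]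
    refine or_congr ?_ Iff.rfl
    refine exists_congr fun i => exists_congr fun j => ?_
    split_ifs <;> simp_all
    omega
  rw [Avoids321, Avoids321, key, not_or, and_comm]

lemma hasInversionBelow_consPerm {n : ℕ} {v : Fin (n + 1)} {π : Perm (Fin n)}
    (h : ¬ HasInversionBelow π v) (w : ℕ) : HasInversionBelow (consPerm (v, π)) w ↔
      (v : ℕ) < w ∧ (0 < (v : ℕ) ∨ HasInversionBelow π (w - 1)) := by
  have key : HasInversionBelow (consPerm (v, π)) w ↔ ((∃ j : Fin n, (π j : ℕ) < v) ∧ (v : ℕ) < w) ∨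
      ∃ i j, i < j ∧ π j < π i ∧ (v.succAbove (π i) : ℕ) < w := by
    simp only [HasInversionBelow, Fin.exists_fin_succ, Fin.succ_lt_succ_iff, consPerm_zero,
      consPerm_succ, Fin.succAbove_lt_succAbove_iff, Fin.succ_pos, Fin.not_lt_zero,
      false_and, false_or, true_and]
    refine or_congr ?_ Iff.rfl
    rw [← exists_and_right]
    refine exists_congr fun j => and_congr_left fun _ => ?_
    rw [Fin.lt_def, val_succAbove]
    split_ifs <;> omega
  have h0 : (∃ j : Fin n, (π j : ℕ) < v) ↔ 0 < (v : ℕ) := by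
    constructor
    · rintro ⟨j, hj⟩; omega
    · intro hv
      refine ⟨π.symm ⟨0, by omega⟩, by simpa using hv⟩
  rw [key, h0]
  constructor
  · rintro (⟨h1, h2⟩ | ⟨i, j, hij, hπ, hw⟩)
    · exact ⟨h2, Or.inl h1⟩
    · have hv : (v : ℕ) ≤ π i := by
        by_contra! hv
        exact h ⟨i, j, hij, hπ, hv⟩
      rw [val_succAbove, if_neg (by omega)] at hw
      exact ⟨by omega, Or.inr ⟨i, j, hij, hπ, by omega⟩⟩
  · rintro ⟨h2, h1 | ⟨i, j, hij, hπ, hw⟩⟩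
    · exact Or.inl ⟨h1, h2⟩
    · refine Or.inr ⟨i, j, hij, hπ, ?_⟩
      rw [val_succAbove]
      split_ifs <;> omega

lemma le_val_succAbove_iff {n : ℕ} (v : Fin (n + 1)) (x : Fin n) (w : ℕ) :
    w ≤ (v.succAbove x : ℕ) ↔ (if w ≤ v then w else w - 1) ≤ (x : ℕ) := by
  rw [val_succAbove]
  split_ifs <;> omega

lemma hasIncreasingFrom_consPerm {n : ℕ} (v : Fin (n + 1)) (π : Perm (Fin n)) (w k : ℕ) :
    HasIncreasingFrom (consPerm (v, π)) w k ↔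
      HasIncreasingFrom π (if w ≤ v then w else w - 1) k ∨
      (w ≤ v ∧ ∃ k', k = k' + 1 ∧ HasIncreasingFrom π v k') := by
  have hmap : ∀ t : Finset (Fin n), (∀ i ∈ t, ∀ j ∈ t, i < j → π i < π j) ↔
      ∀ i ∈ t.map (Fin.succEmb n), ∀ j ∈ t.map (Fin.succEmb n), i < j →
        consPerm (v, π) i < consPerm (v, π) j := by
    intro t
    simp [Fin.succAbove_lt_succAbove_iff]
  constructor
  · rintro ⟨s, hs, hw, rfl⟩
    set t : Finset (Fin n) := Finset.univ.filter (fun i => i.succ ∈ s) with ht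
    have htm : t.map (Fin.succEmb n) = s.erase 0 := by
      ext i
      refine Fin.cases ?_ (fun i => ?_) i
      · simp
      · simp [ht]
    have hts : ∀ i ∈ t, ∀ j ∈ t, i < j → π i < π j := by
      rw [hmap, htm]
      exact fun i hi j hj => hs i (Finset.mem_of_mem_erase hi) j (Finset.mem_of_mem_erase hj)
    have hcard : t.card = (s.erase 0).card := by rw [← htm, Finset.card_map]
    by_cases h0 : 0 ∈ s
    · right
      refine ⟨by simpa using hw 0 h0, t.card, ?_, t, hts, fun i hi => ?_, rfl⟩
      · rw [hcard, Finset.card_erase_add_one h0]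
      · have h1 := hs 0 h0 i.succ (by simpa [ht] using hi) (Fin.succ_pos i)
        rw [consPerm_zero, consPerm_succ, Fin.lt_def, val_succAbove] at h1
        split_ifs at h1 <;> omega
    · left
      refine ⟨t, hts, fun i hi => ?_, by rw [hcard, Finset.erase_eq_of_notMem h0]⟩
      have h1 := hw i.succ (by simpa [ht] using hi)
      rwa [consPerm_succ, le_val_succAbove_iff] at h1
  · rintro (⟨t, ht, hw, rfl⟩ | ⟨hwv, k', rfl, t, ht, hw, rfl⟩)
    · refine ⟨t.map (Fin.succEmb n), (hmap t).1 ht, ?_, Finset.card_map _⟩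
      simpa [le_val_succAbove_iff] using hw
    · refine ⟨insert 0 (t.map (Fin.succEmb n)), ?_, ?_, ?_⟩
      · intro i hi j hj hij
        rcases Finset.mem_insert.1 hj with rfl | hj
        · exact absurd hij (Fin.not_lt_zero i)
        rcases Finset.mem_insert.1 hi with rfl | hi
        · obtain ⟨j, hjt, rfl⟩ := Finset.mem_map.1 hj
          have := hw j hjt
          simp only [Fin.coe_succEmb, consPerm_zero, consPerm_succ, Fin.lt_def, val_succAbove]
          split_ifs <;> omega
        · exact (hmap t).1 ht i hi j hj hij
      · intro i hi
        rcases Finset.mem_insert.1 hi with rfl | hi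
        · simpa using hwv
        · obtain ⟨j, hj, rfl⟩ := Finset.mem_map.1 hi
          have := hw j hj
          simp only [Fin.coe_succEmb, consPerm_succ, val_succAbove]
          split_ifs <;> omega
      · rw [Finset.card_insert_of_notMem (by simp), Finset.card_map]

lemma permWord_spec {n : ℕ} (π : Perm (Fin n)) :
    (permWord n π = none ∧ ¬ Avoids321 π) ∨
    ∃ l, permWord n π = some l ∧ l.length = n ∧ Avoids321 π ∧
      (∀ w, HasInversionBelow π w ↔ [false, true].Sublist (l.take w)) ∧
      ∀ w k, HasIncreasingFrom π w k ↔ k ≤ (l.drop w).count true := by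
  induction n with
  | zero =>
    refine Or.inr ⟨[], rfl, rfl, ?_, ?_, ?_⟩
    · rintro ⟨i, -⟩; exact i.elim0
    · intro w
      simp [HasInversionBelow]
    · intro w k
      simp [HasIncreasingFrom, Finset.eq_empty_of_isEmpty, eq_comm]
  | succ n ih =>
    obtain ⟨⟨v, σ⟩, rfl⟩ := (consPerm_bijective n).2 π
    rw [permWord_consPerm, avoids321_consPerm]
    rcases ih σ with ⟨h1, h2⟩ | ⟨l, h1, hl, h2, hinv, hinc⟩
    · exact Or.inl ⟨by rw [h1, Option.bind_none], fun h => h2 h.1⟩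
    rw [h1, Option.bind_some]
    rcases h3 : insertRow l v with _ | l'
    · refine Or.inl ⟨rfl, fun h => h.2 ((hinv v).2 ?_)⟩
      exact sublist_take_of_insertRow_eq_none (by omega) h3
    have hv : ¬ HasInversionBelow σ v := fun h =>
      not_sublist_take_of_insertRow_eq_some h3 ((hinv v).1 h)
    refine Or.inr ⟨l', rfl, by rw [length_of_insertRow_eq_some h3, hl], ⟨h2, hv⟩,
      fun w => ?_, fun w k => ?_⟩
    · rw [hasInversionBelow_consPerm hv, sublist_take_of_insertRow h3, hinv]
    · rw [hasIncreasingFrom_consPerm, count_drop_of_insertRow h3, hinc]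
      simp only [hinc]
      split_ifs with hw
      · rw [le_max_iff]
        constructor
        · rintro (h | ⟨-, k', rfl, h⟩) <;> omega
        · rintro (h | h)
          · exact Or.inl h
          · rcases k with _ | k
            · exact Or.inl (Nat.zero_le _)
            · exact Or.inr ⟨hw, k, rfl, by omega⟩
      · simp [hw]

lemma lis_eq_of_hasIncreasingFrom {n : ℕ} {π : Perm (Fin n)} {m : ℕ}
    (h : ∀ k, HasIncreasingFrom π 0 k ↔ k ≤ m) : lis π = m := by
  have : {k : ℕ | ∃ s : Finset (Fin n), (∀ i ∈ s, ∀ j ∈ s, i < j → π i < π j) ∧ s.card = k} =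
      Set.Iic m := by
    ext k
    rw [Set.mem_Iic, ← h]
    simp [HasIncreasingFrom]
  rw [lis, this, csSup_Iic]

lemma elim_permWord {n : ℕ} (π : Perm (Fin n)) (k : ℕ) :
    (permWord n π).elim 0 (fun l => if l.count true = k then (1 : ℤ) else 0) =
      if Avoids321 π ∧ lis π = k then 1 else 0 := by
  rcases permWord_spec π with ⟨h1, h2⟩ | ⟨l, h1, -, h2, -, h3⟩
  · simp [h1, h2]
  · have : lis π = l.count true := lis_eq_of_hasIncreasingFrom fun k => by simpa using h3 0 k
    simp [h1, h2, this]

lemma eCount_sub_oCount (n k : ℕ) : (eCount n k : ℤ) - oCount n k =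
    wordSum n (fun l => signedWeight l * if l.count true = k then 1 else 0) := by
  rw [← sum_sign_permWord, eCount, oCount, Nat.card_eq_fintype_card, Nat.card_eq_fintype_card,
    Fintype.card_subtype, Fintype.card_subtype, Finset.card_filter, Finset.card_filter]
  push_cast
  rw [← Finset.sum_sub_distrib]
  refine Finset.sum_congr rfl fun π _ => ?_
  rw [elim_permWord]
  by_cases h : Avoids321 π ∧ lis π = k
  · rcases Int.units_eq_one_or (sign π) with hs | hs <;> simp [h, hs]
  · have h' : ∀ p : Prop, ¬ (Avoids321 π ∧ lis π = k ∧ p) := fun p hp => h ⟨hp.1, hp.2.1⟩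
    simp [h, h']

end TwoRow

theorem e_sub_o_even_odd (n k : ℕ) :
    (eCount (2 * n + 2) (2 * k + 1) : ℤ) - (oCount (2 * n + 2) (2 * k + 1) : ℤ)
      = -(ballotNum n k : ℤ) ^ 2 := by
  rw [TwoRow.eCount_sub_oCount]
  rcases Nat.lt_or_ge n k with h | h
  · rw [TwoRow.ballotNum_eq_zero (Or.inr h)]
    simpa using TwoRow.wordSum_signedWeight_eq_zero (by omega)
  obtain ⟨j, rfl⟩ := Nat.exists_eq_add_of_le h
  rw [TwoRow.wordSum_signedWeight (show 2 * k + 1 + (2 * j + 1) = 2 * (k + j) + 2 by ring),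
    pow_succ, pow_mul]
  rcases Nat.lt_or_ge k j with hj | hj
  · rw [TwoRow.ballotNum_eq_zero (Or.inl (by omega)), TwoRow.signSum_eq_zero (by omega)]
    simp
  · rw [TwoRow.ballotNum_eq_signSum hj]
    simp
end
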